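/- There exists a positive constant C such that for all N ≥ 1 and all i, j ∈ Λ^N with i ≠ j, the covariances under the invariant measure satisfy |σ^N(i,j)| ≤ C N³. -/

import Mathlib

open MeasureTheory ProbabilityTheory Filter

noncomputable section

/-- The uniform distribution on `[0,1]`. -/
def unif01 : Measure ℝ := volume.restrict (Set.Icc (0:ℝ) 1)

/-- Truncation of a configuration to the box `Λ^N = {1,…,N}` (zero outside). -/
def trunc (N : ℕ) (w : ℤ → ℝ) : ℤ → ℝ :=
  fun i => if 1 ≤ i ∧ i ≤ (N : ℤ) then w i else 0

/-- One step of the width-`N` silo dynamics with fractions `u` and added weights `v`. -/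
def siloStep (N : ℕ) (u v w : ℤ → ℝ) : ℤ → ℝ :=
  trunc N fun i => v i + trunc N w (i + 1) * u (i + 1) + trunc N w (i - 1) * (1 - u (i - 1))

/-- `ν` is the product measure on `ℤ → ℝ` with all marginals `m`
(characterized through its finite-dimensional distributions). -/
def IsProductLaw (m : Measure ℝ) (ν : Measure (ℤ → ℝ)) : Prop :=
  IsProbabilityMeasure ν ∧
    ∀ I : Finset ℤ, ν.map (fun w (i : I) => w (i : ℤ)) = Measure.pi fun _ : I => m

/-- The law on `ℤ → ℝ` which is iid `m` on the finite window `I` and `0` elsewhere. -/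
def finExtLaw (I : Finset ℤ) (m : Measure ℝ) : Measure (ℤ → ℝ) :=
  (Measure.pi fun _ : I => m).map fun f i => if h : i ∈ I then f ⟨i, h⟩ else 0

/-- Law of the pair (fractions, weights) driving one step of the width-`N` silo. -/
def siloDriveLaw (N : ℕ) (νV : Measure ℝ) : Measure ((ℤ → ℝ) × (ℤ → ℝ)) :=
  (finExtLaw (Finset.Icc 0 ((N : ℤ) + 1)) unif01).prod (finExtLaw (Finset.Icc 1 (N : ℤ)) νV)

/-- `μ` is carried by the state space `[0,∞)^{Λ^N}`. -/
def SiloSupported (N : ℕ) (μ : Measure (ℤ → ℝ)) : Prop :=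
  μ {w | ∀ i : ℤ, 0 ≤ w i ∧ (¬(1 ≤ i ∧ i ≤ (N : ℤ)) → w i = 0)} = 1

/-- Hypotheses on the common law of the grain weights `V_t(i)`: a probability measure on
`[0,∞)` with mean `1` and finite variance. -/
def IsVLaw (νV : Measure ℝ) : Prop :=
  IsProbabilityMeasure νV ∧ νV {x | x < 0} = 0 ∧ (∫ x, x ∂νV) = 1 ∧
    Integrable (fun x => x ^ 2) νV

/-- `μ` is an invariant probability measure for the width-`N` silo process. -/
def IsSiloInvariant (N : ℕ) (νV : Measure ℝ) (μ : Measure (ℤ → ℝ)) : Prop :=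
  IsProbabilityMeasure μ ∧ SiloSupported N μ ∧
    (μ.prod (siloDriveLaw N νV)).map (fun p => siloStep N p.2.1 p.2.2 p.1) = μ

/-- The law of the silo process at time `t`, started from the distribution `μ0`. -/
def siloChainLaw (N : ℕ) (νV : Measure ℝ) (μ0 : Measure (ℤ → ℝ)) : ℕ → Measure (ℤ → ℝ)
  | 0 => μ0
  | t + 1 =>
      ((siloChainLaw N νV μ0 t).prod (siloDriveLaw N νV)).map
        fun p => siloStep N p.2.1 p.2.2 p.1

/-- One step of the infinite silo model with fractions `u`. -/
def ismStep (u η : ℤ → ℝ) : ℤ → ℝ :=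
  fun i => η (i - 1) * u (i - 1) + η (i + 1) * (1 - u (i + 1))

/-- `ν` is invariant for the infinite silo model. -/
def IsISMInvariant (ν : Measure (ℤ → ℝ)) : Prop :=
  ∀ κ : Measure (ℤ → ℝ), IsProductLaw unif01 κ →
    ((ν.prod κ).map fun p => ismStep p.2 p.1) = ν

/-- The shift `τ_1` on configurations. -/
def shift1 (η : ℤ → ℝ) : ℤ → ℝ := fun i => η (i - 1)

/-- `ν` plays the role of `ν_ρ`: the product of Gamma(2, 2/ρ) laws for `ρ ≠ 0`,
and the point mass at the zero configuration for `ρ = 0`. -/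
def IsNuRho (ρ : ℝ) (ν : Measure (ℤ → ℝ)) : Prop :=
  (ρ = 0 → ν = Measure.dirac fun _ => 0) ∧
    (ρ ≠ 0 → IsProductLaw (gammaMeasure 2 (2 / ρ)) ν)

/-- The mean profile `i (N + 1 - i)` of the width-`N` silo. -/
def siloMean (N : ℕ) (i : ℤ) : ℝ := (i : ℝ) * ((N : ℝ) + 1 - (i : ℝ))

/-- Uniqueness for the discrete Poisson equation on `{1,…,N}` with zero boundary values. -/
lemma eq_siloMean_of_average (N : ℕ) (m : ℤ → ℝ) (h0 : m 0 = 0) (hN : m ((N : ℤ) + 1) = 0)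
    (hm : ∀ i : ℤ, 1 ≤ i → i ≤ N → m i = 1 + (m (i + 1) + m (i - 1)) / 2)
    (i : ℤ) (hi0 : 0 ≤ i) (hiN : i ≤ (N : ℤ) + 1) : m i = siloMean N i := by
  have key : ∀ n : ℕ, n ≤ N →
      m n - siloMean N n = n * (m 1 - siloMean N 1) ∧
        m ((n : ℤ) + 1) - siloMean N ((n : ℤ) + 1) = (n + 1) * (m 1 - siloMean N 1) := by
    intro n
    induction n with
    | zero => intro _; simp [h0, siloMean]
    | succ n ih =>
      intro hn
      obtain ⟨h1, h2⟩ := ih (by omega)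
      have h3 := hm ((n : ℤ) + 1) (by omega) (by omega)
      rw [add_sub_cancel_right] at h3
      push_cast
      refine ⟨h2, ?_⟩
      simp only [siloMean] at *
      push_cast at *
      linarith
  have hz : m 1 - siloMean N 1 = 0 := by
    have h := (key N le_rfl).2
    rw [hN] at h
    have h' : ((N : ℝ) + 1) * (m 1 - siloMean N 1) = 0 := by
      rw [← h]; simp [siloMean]
    exact (mul_eq_zero.1 h').resolve_left (by positivity)
  obtain ⟨n, rfl⟩ := Int.eq_ofNat_of_zero_le hi0
  rcases Nat.lt_or_ge N n with hn | hn
  · obtain rfl : n = N + 1 := by omega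
    have := (key N le_rfl).2
    rw [hz] at this
    push_cast
    linarith
  · have := (key n hn).1
    rw [hz] at this
    linarith

/-- Maximum principle for the pair of silo walkers: they jump independently when at distinct
sites, and from a common site they jump together with probability `2/3`. -/
lemma pair_walk_max_principle (N : ℕ) (f : ℤ → ℤ → ℝ)
    (hb : ∀ i j : ℤ, 0 ≤ i → i ≤ (N : ℤ) + 1 → 0 ≤ j → j ≤ (N : ℤ) + 1 →
      (i = 0 ∨ i = (N : ℤ) + 1 ∨ j = 0 ∨ j = (N : ℤ) + 1) → f i j ≤ 0)
    (hd : ∀ i : ℤ, 1 ≤ i → i ≤ N → f i i ≤ (f (i + 1) (i + 1) + f (i - 1) (i - 1)) / 3 +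
      (f (i + 1) (i - 1) + f (i - 1) (i + 1)) / 6)
    (ho : ∀ i j : ℤ, 1 ≤ i → i ≤ N → 1 ≤ j → j ≤ N → i ≠ j → f i j ≤
      (f (i + 1) (j + 1) + f (i + 1) (j - 1) + f (i - 1) (j + 1) + f (i - 1) (j - 1)) / 4)
    (i j : ℤ) (hi0 : 0 ≤ i) (hiN : i ≤ (N : ℤ) + 1) (hj0 : 0 ≤ j) (hjN : j ≤ (N : ℤ) + 1) :
    f i j ≤ 0 := by
  by_contra! hpos
  set B : Finset (ℤ × ℤ) := Finset.Icc 0 ((N : ℤ) + 1) ×ˢ Finset.Icc 0 ((N : ℤ) + 1) with hB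
  have hBm : ∀ a b : ℤ, (a, b) ∈ B ↔
      (0 ≤ a ∧ a ≤ (N : ℤ) + 1) ∧ (0 ≤ b ∧ b ≤ (N : ℤ) + 1) := by
    intro a b; simp [hB, Finset.mem_product, Finset.mem_Icc]
  obtain ⟨p, hpB, hp⟩ := B.exists_max_image (fun q => f q.1 q.2)
    ⟨(i, j), (hBm _ _).2 ⟨⟨hi0, hiN⟩, hj0, hjN⟩⟩
  obtain ⟨a, b⟩ := p
  have hmax : ∀ c d : ℤ, 0 ≤ c → c ≤ (N : ℤ) + 1 → 0 ≤ d → d ≤ (N : ℤ) + 1 →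
      f c d ≤ f a b := fun c d h1 h2 h3 h4 => hp (c, d) ((hBm _ _).2 ⟨⟨h1, h2⟩, h3, h4⟩)
  have hspos : 0 < f a b := hpos.trans_le (hmax i j hi0 hiN hj0 hjN)
  have hab := (hBm a b).1 hpB
  have key : ∀ k : ℕ, a + k ≤ (N : ℤ) + 1 ∧ b + k ≤ (N : ℤ) + 1 ∧ f (a + k) (b + k) = f a b := by
    intro k
    induction k with
    | zero => simpa using ⟨hab.1.2, hab.2.2⟩
    | succ k ih =>
      obtain ⟨h1, h2, h3⟩ := ih
      have hin : ¬(a + k = 0 ∨ a + k = (N : ℤ) + 1 ∨ b + k = 0 ∨ b + k = (N : ℤ) + 1) := by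
        intro hc
        have := hb (a + k) (b + k) (by omega) h1 (by omega) h2 hc
        linarith
      push_cast
      rw [← add_assoc, ← add_assoc]
      set c := a + (k : ℤ)
      set d := b + (k : ℤ)
      refine ⟨by omega, by omega, ?_⟩
      have e1 := hmax (c + 1) (d + 1) (by omega) (by omega) (by omega) (by omega)
      have e2 := hmax (c + 1) (d - 1) (by omega) (by omega) (by omega) (by omega)
      have e3 := hmax (c - 1) (d + 1) (by omega) (by omega) (by omega) (by omega)
      have e4 := hmax (c - 1) (d - 1) (by omega) (by omega) (by omega) (by omega)
      by_cases hcd : c = d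
      · have := hd c (by omega) (by omega)
        rw [← hcd] at e1 e2 e3 e4 h3 ⊢
        linarith
      · have := ho c d (by omega) (by omega) (by omega) (by omega) hcd
        linarith
  have := (key (N + 2)).1
  push_cast at this
  omega

/-- A function on pairs that is harmonic for the pair walk up to a source `s` on the diagonal
is bounded by a multiple of `N + 1 - |i - j|`. -/
lemma pair_walk_le (N : ℕ) (f : ℤ → ℤ → ℝ) (s : ℤ → ℝ) (R : ℝ) (hR : 0 ≤ R)
    (hb : ∀ i j : ℤ, 0 ≤ i → i ≤ (N : ℤ) + 1 → 0 ≤ j → j ≤ (N : ℤ) + 1 →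
      (i = 0 ∨ i = (N : ℤ) + 1 ∨ j = 0 ∨ j = (N : ℤ) + 1) → f i j = 0)
    (hd : ∀ i : ℤ, 1 ≤ i → i ≤ N → f i i = (f (i + 1) (i + 1) + f (i - 1) (i - 1)) / 3 +
      (f (i + 1) (i - 1) + f (i - 1) (i + 1)) / 6 + s i)
    (ho : ∀ i j : ℤ, 1 ≤ i → i ≤ N → 1 ≤ j → j ≤ N → i ≠ j → f i j =
      (f (i + 1) (j + 1) + f (i + 1) (j - 1) + f (i - 1) (j + 1) + f (i - 1) (j - 1)) / 4)
    (hs : ∀ i : ℤ, 1 ≤ i → i ≤ N → s i ≤ 2 / 3 * R)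
    (i j : ℤ) (hi0 : 0 ≤ i) (hiN : i ≤ (N : ℤ) + 1) (hj0 : 0 ≤ j) (hjN : j ≤ (N : ℤ) + 1) :
    f i j ≤ R * ((N : ℝ) + 1 - |(i : ℝ) - j|) := by
  have := pair_walk_max_principle N
    (fun i j => f i j - R * ((N : ℝ) + 1 - |(i : ℝ) - j|)) ?_ ?_ ?_ i j hi0 hiN hj0 hjN
  · simpa using this
  · intro i j h1 h2 h3 h4 h5
    simp only [hb i j h1 h2 h3 h4 h5]
    have h1' : (0 : ℝ) ≤ i := by exact_mod_cast h1
    have h2' : (i : ℝ) ≤ N + 1 := by exact_mod_cast h2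
    have h3' : (0 : ℝ) ≤ j := by exact_mod_cast h3
    have h4' : (j : ℝ) ≤ N + 1 := by exact_mod_cast h4
    have : |(i : ℝ) - j| ≤ N + 1 := abs_le.2 ⟨by linarith, by linarith⟩
    have := mul_nonneg hR (sub_nonneg.2 this)
    linarith
  · intro i h1 h2
    simp only [hd i h1 h2]
    push_cast
    have e1 : |(i : ℝ) + 1 - (i - 1)| = 2 := by
      rw [show (i : ℝ) + 1 - (i - 1) = 2 by ring]; norm_num
    have e2 : |(i : ℝ) - 1 - (i + 1)| = 2 := by
      rw [show (i : ℝ) - 1 - (i + 1) = -2 by ring]; norm_num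
    rw [e1, e2]
    simp only [sub_self, abs_zero]
    have := hs i h1 h2
    linarith
  · intro i j h1 h2 h3 h4 hij
    simp only [ho i j h1 h2 h3 h4 hij]
    push_cast
    have e1 : (i : ℝ) + 1 - (j + 1) = i - j := by ring
    have e2 : (i : ℝ) - 1 - (j - 1) = i - j := by ring
    have e3 : 2 * |(i : ℝ) - j| ≤ |(i : ℝ) + 1 - (j - 1)| + |(i : ℝ) - 1 - (j + 1)| := by
      refine le_trans (le_of_eq ?_) (abs_add_le _ _)
      rw [show (i : ℝ) + 1 - (j - 1) + (i - 1 - (j + 1)) = 2 * (i - j) by ring, abs_mul]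
      norm_num
    rw [e1, e2]
    have := mul_le_mul_of_nonneg_left e3 hR
    linarith

lemma siloMean_nonneg (N : ℕ) (i : ℤ) (h0 : 0 ≤ i) (hN : i ≤ (N : ℤ) + 1) : 0 ≤ siloMean N i := by
  have h1 : (0 : ℝ) ≤ i := by exact_mod_cast h0
  have h2 : (i : ℝ) ≤ N + 1 := by exact_mod_cast hN
  exact mul_nonneg h1 (by linarith)

/-- The second-moment equations of the silo process force the off-diagonal covariances to be of
order `N ^ 3`. -/
lemma covariance_bound_of_moment_equations (N : ℕ) (hN : 1 ≤ N) (β : ℝ) (hβ : 0 ≤ β)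
    (M : ℤ → ℤ → ℝ)
    (hM0 : ∀ i j : ℤ, (i = 0 ∨ i = (N : ℤ) + 1 ∨ j = 0 ∨ j = (N : ℤ) + 1) → M i j = 0)
    (hM : ∀ i j : ℤ, 1 ≤ i → i ≤ N → 1 ≤ j → j ≤ N → M i j =
      1 + (siloMean N (i + 1) + siloMean N (i - 1)) / 2 +
        (siloMean N (j + 1) + siloMean N (j - 1)) / 2 +
        (M (i + 1) (j + 1) + M (i + 1) (j - 1) + M (i - 1) (j + 1) + M (i - 1) (j - 1)) / 4 +
        (if i = j then (β - 1) + (M (i + 1) (j + 1) + M (i - 1) (j - 1)) / 12 else 0) -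
        (if i + 1 = j - 1 then M (i + 1) (j - 1) / 12 else 0) -
        (if i - 1 = j + 1 then M (i - 1) (j + 1) / 12 else 0))
    (i j : ℤ) (hi1 : 1 ≤ i) (hiN : i ≤ N) (hj1 : 1 ≤ j) (hjN : j ≤ N) (hij : i ≠ j) :
    |M i j - siloMean N i * siloMean N j| ≤ (4 + 4 * β) * (N : ℝ) ^ 3 := by
  have hN' : (1 : ℝ) ≤ N := by exact_mod_cast hN
  set f : ℤ → ℤ → ℝ := fun i j =>
    (if i = j then 2 / 3 * M i j else M i j) - siloMean N i * siloMean N j with hf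
  set s : ℤ → ℝ := fun i => 2 / 3 * (((N : ℝ) + 1) ^ 2 / 2 - 3 * siloMean N i + β - 1 / 2) with hs
  set R : ℝ := ((N : ℝ) + 1) ^ 2 / 2 + β with hR
  have hR0 : 0 ≤ R := by positivity
  have fb : ∀ i j : ℤ, 0 ≤ i → i ≤ (N : ℤ) + 1 → 0 ≤ j → j ≤ (N : ℤ) + 1 →
      (i = 0 ∨ i = (N : ℤ) + 1 ∨ j = 0 ∨ j = (N : ℤ) + 1) → f i j = 0 := by
    intro i j _ _ _ _ h
    have h' : siloMean N i * siloMean N j = 0 := by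
      rcases h with h | h | h | h <;> simp [h, siloMean]
    simp [hf, hM0 i j h, h']
  have fd : ∀ i : ℤ, 1 ≤ i → i ≤ N → f i i = (f (i + 1) (i + 1) + f (i - 1) (i - 1)) / 3 +
      (f (i + 1) (i - 1) + f (i - 1) (i + 1)) / 6 + s i := by
    intro i h1 h2
    have h := hM i i h1 h2 h1 h2
    rw [if_pos rfl, if_neg (by omega), if_neg (by omega)] at h
    simp only [hf, if_true, if_neg (show ¬(i + 1 = i - 1) by omega),
      if_neg (show ¬(i - 1 = i + 1) by omega), hs]
    rw [h]
    simp only [siloMean]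
    push_cast
    ring
  have fo : ∀ i j : ℤ, 1 ≤ i → i ≤ N → 1 ≤ j → j ≤ N → i ≠ j → f i j =
      (f (i + 1) (j + 1) + f (i + 1) (j - 1) + f (i - 1) (j + 1) + f (i - 1) (j - 1)) / 4 := by
    intro i j h1 h2 h3 h4 hne
    have h := hM i j h1 h2 h3 h4
    rw [if_neg hne] at h
    simp only [hf, if_neg hne, if_neg (show ¬(i + 1 = j + 1) by omega),
      if_neg (show ¬(i - 1 = j - 1) by omega)]
    rw [h]
    by_cases ha : i + 1 = j - 1
    · have hb : ¬(i - 1 = j + 1) := by omega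
      simp only [if_pos ha, if_neg hb, siloMean]
      push_cast
      ring
    · by_cases hb : i - 1 = j + 1
      · simp only [if_neg ha, if_pos hb, siloMean]
        push_cast
        ring
      · simp only [if_neg ha, if_neg hb, siloMean]
        push_cast
        ring
  have hs1 : ∀ i : ℤ, 1 ≤ i → i ≤ N → s i ≤ 2 / 3 * R := by
    intro i h1 h2
    have := siloMean_nonneg N i (by omega) (by omega)
    simp only [hs, hR]
    linarith
  have hs2 : ∀ i : ℤ, 1 ≤ i → i ≤ N → -s i ≤ 2 / 3 * R := by
    intro i _ _
    have : siloMean N i ≤ ((N : ℝ) + 1) ^ 2 / 4 := by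
      simp only [siloMean]
      nlinarith [sq_nonneg ((N : ℝ) + 1 - 2 * i)]
    simp only [hs, hR]
    nlinarith
  have u1 := pair_walk_le N f s R hR0 fb fd fo hs1 i j (by omega) (by omega) (by omega) (by omega)
  have u2 := pair_walk_le N (fun i j => -f i j) (fun i => -s i) R hR0
    (fun i j h1 h2 h3 h4 h5 => by simp only [fb i j h1 h2 h3 h4 h5, neg_zero])
    (fun i h1 h2 => by simp only [fd i h1 h2]; ring)
    (fun i j h1 h2 h3 h4 h5 => by simp only [fo i j h1 h2 h3 h4 h5]; ring) hs2
    i j (by omega) (by omega) (by omega) (by omega)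
  have e : f i j = M i j - siloMean N i * siloMean N j := by simp only [hf, if_neg hij]
  have v : R * ((N : ℝ) + 1 - |(i : ℝ) - j|) ≤ (4 + 4 * β) * (N : ℝ) ^ 3 := by
    have a1 : R ≤ (2 + β) * (N : ℝ) ^ 2 := by
      simp only [hR]
      nlinarith [mul_nonneg hβ (show (0 : ℝ) ≤ (N : ℝ) ^ 2 - 1 by nlinarith)]
    have a2 : (N : ℝ) + 1 - |(i : ℝ) - j| ≤ 2 * N := by linarith [abs_nonneg ((i : ℝ) - j)]
    calc R * ((N : ℝ) + 1 - |(i : ℝ) - j|) ≤ R * (2 * N) := mul_le_mul_of_nonneg_left a2 hR0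
      _ ≤ (2 + β) * (N : ℝ) ^ 2 * (2 * N) := mul_le_mul_of_nonneg_right a1 (by positivity)
      _ ≤ (4 + 4 * β) * (N : ℝ) ^ 3 := by
        have : 0 ≤ β * (N : ℝ) ^ 3 := by positivity
        nlinarith
  rw [← e]
  exact abs_le.2 ⟨by linarith, by linarith⟩

section Drive

instance isProbabilityMeasure_unif01 : IsProbabilityMeasure unif01 :=
  ⟨by simp [unif01]⟩

lemma measurable_finExt (I : Finset ℤ) :
    Measurable fun (f : I → ℝ) (i : ℤ) => if h : i ∈ I then f ⟨i, h⟩ else 0 := by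
  refine measurable_pi_lambda _ fun i => ?_
  by_cases h : i ∈ I
  · simpa [h] using measurable_pi_apply _
  · simp [h]

variable (I : Finset ℤ) (m : Measure ℝ) [IsProbabilityMeasure m]

instance isProbabilityMeasure_finExtLaw : IsProbabilityMeasure (finExtLaw I m) :=
  Measure.isProbabilityMeasure_map (measurable_finExt I).aemeasurable

variable {I}

lemma measurePreserving_finExtLaw_eval {k : ℤ} (hk : k ∈ I) :
    MeasurePreserving (fun w : ℤ → ℝ => w k) (finExtLaw I m) m := by
  refine ⟨measurable_pi_apply k, ?_⟩
  rw [finExtLaw, Measure.map_map (measurable_pi_apply k) (measurable_finExt I)]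
  have : ((fun w : ℤ → ℝ => w k) ∘ fun (f : I → ℝ) (i : ℤ) => if h : i ∈ I then f ⟨i, h⟩ else 0) =
      Function.eval ⟨k, hk⟩ := by
    ext f; simp [hk]
  rw [this]
  exact (measurePreserving_eval (fun _ : I => m) ⟨k, hk⟩).map_eq

lemma integral_finExtLaw_mul {k l : ℤ} (hk : k ∈ I) (hl : l ∈ I) (hkl : k ≠ l) {f g : ℝ → ℝ}
    (hf : Measurable f) (hg : Measurable g) :
    ∫ w, f (w k) * g (w l) ∂(finExtLaw I m) = (∫ x, f x ∂m) * ∫ x, g x ∂m := by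
  have hind := (iIndepFun_pi (μ := fun _ : I => m) (X := fun _ x => x)
    (fun _ => aemeasurable_id)).indepFun (i := ⟨k, hk⟩) (j := ⟨l, hl⟩) (by simpa using hkl)
  have hind' := (hind.comp hf hg).integral_fun_mul_eq_mul_integral
    (hf.comp (measurable_pi_apply _)).aestronglyMeasurable
    (hg.comp (measurable_pi_apply _)).aestronglyMeasurable
  rw [finExtLaw, integral_map (measurable_finExt I).aemeasurable
    (by fun_prop)]
  simp only [hk, hl, dite_true]
  simp only [Function.comp_apply] at hind'
  rw [hind']
  have e : ∀ (p : I) {f : ℝ → ℝ}, Measurable f →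
      ∫ x : I → ℝ, f (x p) ∂(Measure.pi fun _ : I => m) = ∫ x, f x ∂m := by
    intro p f hf
    conv_rhs => rw [← (measurePreserving_eval (fun _ : I => m) p).map_eq]
    rw [integral_map (measurable_pi_apply p).aemeasurable (by fun_prop)]
  rw [e _ hf, e _ hg]

end Drive

/-- Foster–Lyapunov criterion: if `V` drifts down by `g` up to a constant, then `g` is integrable
for every invariant probability measure. -/
lemma integrable_of_drift {X Y : Type*} [MeasurableSpace X] [MeasurableSpace Y]
    (μ : Measure X) (D : Measure Y) [IsProbabilityMeasure μ] [IsProbabilityMeasure D]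
    (T : X × Y → X) (hT : Measurable T) (hinv : (μ.prod D).map T = μ)
    (V g : X → ℝ) (hV : Measurable V) (hg : Measurable g) (hV0 : ∀ x, 0 ≤ V x)
    (hg0 : ∀ x, 0 ≤ g x) (b : ℝ) (hb : 0 ≤ b)
    (hdrift : ∀ᵐ x ∂μ, Integrable (fun y => V (T (x, y))) D ∧
      ∫ y, V (T (x, y)) ∂D ≤ V x - g x + b) :
    Integrable g μ := by
  have hcover : AECover μ atTop fun n : ℕ => {x | V x ≤ n} := by
    refine ⟨ae_of_all _ fun x => ?_, fun n => measurableSet_le hV measurable_const⟩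
    obtain ⟨n, hn⟩ := exists_nat_ge (V x)
    filter_upwards [eventually_ge_atTop n] with k hk
    exact hn.trans (by exact_mod_cast hk)
  have hgV : ∀ᵐ x ∂μ, g x ≤ V x + b := by
    filter_upwards [hdrift] with x hx
    have : 0 ≤ ∫ y, V (T (x, y)) ∂D := integral_nonneg fun y => hV0 _
    linarith [hx.2]
  have hintg : ∀ n : ℕ, IntegrableOn g {x | V x ≤ n} μ := by
    intro n
    refine Integrable.mono' (integrable_const ((n : ℝ) + b)) hg.aestronglyMeasurable ?_
    filter_upwards [ae_restrict_of_ae hgV, ae_restrict_mem (hcover.measurableSet n)] with x h1 h2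
    rw [Real.norm_of_nonneg (hg0 x)]
    exact h1.trans (by simpa using h2)
  refine hcover.integrable_of_integral_bounded_of_nonneg_ae b hintg (ae_of_all _ hg0)
    (Eventually.of_forall fun n => ?_)
  set φ : X → ℝ := fun x => min (V x) n with hφ
  have hφm : Measurable φ := by fun_prop
  have hφb : ∀ x, ‖φ x‖ ≤ n := fun x => by
    rw [Real.norm_of_nonneg (le_min (hV0 x) n.cast_nonneg)]; exact min_le_right _ _
  have hφi : Integrable φ μ :=
    Integrable.mono' (integrable_const (n : ℝ)) hφm.aestronglyMeasurable (ae_of_all _ hφb)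
  have hφT : Integrable (fun p => φ (T p)) (μ.prod D) :=
    Integrable.mono' (integrable_const (n : ℝ)) (hφm.comp hT).aestronglyMeasurable
      (ae_of_all _ fun p => hφb _)
  have hgi : Integrable ({x | V x ≤ n}.indicator g) μ :=
    (integrable_indicator_iff (hcover.measurableSet n)).2 (hintg n)
  have e1 : ∫ x, φ x ∂μ = ∫ x, ∫ y, φ (T (x, y)) ∂D ∂μ := by
    conv_lhs => rw [← hinv]
    rw [integral_map hT.aemeasurable hφm.aestronglyMeasurable, integral_prod _ hφT]
  have e2 : ∫ x, ∫ y, φ (T (x, y)) ∂D ∂μ ≤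
      ∫ x, (φ x - {x | V x ≤ n}.indicator g x + b) ∂μ := by
    refine integral_mono_ae hφT.integral_prod_left
      ((hφi.sub hgi).add (integrable_const b)) ?_
    filter_upwards [hdrift] with x hx
    have hxi : Integrable (fun y => φ (T (x, y))) D :=
      Integrable.mono' (integrable_const (n : ℝ))
        (hφm.comp (hT.comp measurable_prodMk_left)).aestronglyMeasurable
        (ae_of_all _ fun p => hφb _)
    have i1 : ∫ y, φ (T (x, y)) ∂D ≤ ∫ y, V (T (x, y)) ∂D :=
      integral_mono hxi hx.1 fun y => min_le_left _ _
    have i2 : ∫ y, φ (T (x, y)) ∂D ≤ n := by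
      have := integral_mono hxi (integrable_const (n : ℝ)) fun y => min_le_right _ _
      simpa using this
    by_cases hVx : V x ≤ n
    · simp only [hφ, Set.indicator_of_mem (show x ∈ {x | V x ≤ n} from hVx), min_eq_left hVx]
      exact i1.trans hx.2
    · simp only [hφ, Set.indicator_of_notMem (show x ∉ {x | V x ≤ n} from hVx),
        min_eq_right (not_le.1 hVx).le]
      simp only [hφ] at i2
      linarith
  have hsub : Integrable (fun x => φ x - {x | V x ≤ n}.indicator g x) μ := hφi.sub hgi
  rw [integral_add hsub (integrable_const b), integral_sub hφi hgi,
    integral_indicator (hcover.measurableSet n), ← e1] at e2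
  simp at e2
  linarith

section DriveMoments

lemma memLp_id_unif01 : MemLp (fun x : ℝ => x) 2 unif01 := by
  refine MemLp.of_bound aestronglyMeasurable_id 1 ?_
  filter_upwards [ae_restrict_mem measurableSet_Icc] with x hx
  rw [Real.norm_eq_abs, abs_le]
  exact ⟨by linarith [hx.1], hx.2⟩

lemma integral_unif01_sub_half : ∫ x, (x - 1 / 2) ∂unif01 = 0 := by
  rw [unif01, integral_Icc_eq_integral_Ioc, ← intervalIntegral.integral_of_le zero_le_one]
  rw [intervalIntegral.integral_comp_sub_right (fun x => x) (1 / 2 : ℝ), integral_id]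
  norm_num

lemma integral_unif01_sub_half_sq : ∫ x, (x - 1 / 2) * (x - 1 / 2) ∂unif01 = 1 / 12 := by
  rw [unif01, integral_Icc_eq_integral_Ioc, ← intervalIntegral.integral_of_le zero_le_one]
  simp only [← pow_two]
  rw [intervalIntegral.integral_comp_sub_right (fun x => x ^ 2) (1 / 2 : ℝ), integral_pow]
  norm_num

variable {νV : Measure ℝ}

lemma IsVLaw.memLp_id (hνV : IsVLaw νV) : MemLp (fun x : ℝ => x) 2 νV :=
  (memLp_two_iff_integrable_sq aestronglyMeasurable_id).2 hνV.2.2.2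

lemma IsVLaw.integral_sub_one (hνV : IsVLaw νV) : ∫ x, (x - 1) ∂νV = 0 := by
  have := hνV.1
  rw [integral_sub (hνV.memLp_id.integrable (by norm_num)) (integrable_const _), hνV.2.2.1]
  simp

lemma IsVLaw.integral_sub_one_sq (hνV : IsVLaw νV) :
    ∫ x, (x - 1) * (x - 1) ∂νV = (∫ x, x ^ 2 ∂νV) - 1 := by
  have := hνV.1
  have hi : Integrable (fun x : ℝ => x) νV := hνV.memLp_id.integrable (by norm_num)
  have e : ∀ x : ℝ, (x - 1) * (x - 1) = x ^ 2 - (2 * x - 1) := fun x => by ring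
  simp only [e]
  have hi' : Integrable (fun x : ℝ => 2 * x - 1) νV :=
    (hi.const_mul 2).sub (integrable_const 1)
  rw [integral_sub hνV.2.2.2 hi', integral_sub (hi.const_mul 2) (integrable_const 1),
    integral_const_mul, hνV.2.2.1]
  simp
  norm_num

variable (N : ℕ)

lemma isProbabilityMeasure_siloDriveLaw (hνV : IsVLaw νV) :
    IsProbabilityMeasure (siloDriveLaw N νV) := by
  have := hνV.1
  unfold siloDriveLaw
  infer_instance

lemma measurePreserving_drive_fst (hνV : IsVLaw νV) {k : ℤ}
    (hk : k ∈ Finset.Icc 0 ((N : ℤ) + 1)) :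
    MeasurePreserving (fun d : (ℤ → ℝ) × (ℤ → ℝ) => d.1 k) (siloDriveLaw N νV) unif01 := by
  have := hνV.1
  exact (measurePreserving_finExtLaw_eval unif01 hk).comp measurePreserving_fst

lemma measurePreserving_drive_snd (hνV : IsVLaw νV) {i : ℤ} (hi : i ∈ Finset.Icc 1 (N : ℤ)) :
    MeasurePreserving (fun d : (ℤ → ℝ) × (ℤ → ℝ) => d.2 i) (siloDriveLaw N νV) νV := by
  have := hνV.1
  exact (measurePreserving_finExtLaw_eval νV hi).comp measurePreserving_snd

lemma memLp_drive_fst (hνV : IsVLaw νV) {k : ℤ} (hk : k ∈ Finset.Icc 0 ((N : ℤ) + 1)) :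
    MemLp (fun d : (ℤ → ℝ) × (ℤ → ℝ) => d.1 k - 1 / 2) 2 (siloDriveLaw N νV) := by
  have := isProbabilityMeasure_siloDriveLaw N hνV
  exact (memLp_id_unif01.comp_measurePreserving (measurePreserving_drive_fst N hνV hk)).sub
    (memLp_const _)

lemma memLp_drive_snd (hνV : IsVLaw νV) {i : ℤ} (hi : i ∈ Finset.Icc 1 (N : ℤ)) :
    MemLp (fun d : (ℤ → ℝ) × (ℤ → ℝ) => d.2 i) 2 (siloDriveLaw N νV) :=
  hνV.memLp_id.comp_measurePreserving (measurePreserving_drive_snd N hνV hi)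

lemma integral_drive_fst (hνV : IsVLaw νV) {k : ℤ} (hk : k ∈ Finset.Icc 0 ((N : ℤ) + 1)) :
    ∫ d, (d.1 k - 1 / 2) ∂(siloDriveLaw N νV) = 0 := by
  have h := measurePreserving_drive_fst N hνV hk
  rw [← integral_unif01_sub_half, ← h.map_eq,
    integral_map h.measurable.aemeasurable (by fun_prop)]

lemma integral_drive_snd (hνV : IsVLaw νV) {i : ℤ} (hi : i ∈ Finset.Icc 1 (N : ℤ)) :
    ∫ d, (d.2 i - 1) ∂(siloDriveLaw N νV) = 0 := by
  have h := measurePreserving_drive_snd N hνV hi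
  rw [← hνV.integral_sub_one]
  conv_rhs => rw [← h.map_eq]
  rw [integral_map h.measurable.aemeasurable (by fun_prop)]

lemma integral_drive_fst_mul_snd (hνV : IsVLaw νV) {f g : (ℤ → ℝ) → ℝ} :
    ∫ d, f d.1 * g d.2 ∂(siloDriveLaw N νV) =
      (∫ u, f u ∂(finExtLaw (Finset.Icc 0 ((N : ℤ) + 1)) unif01)) *
        ∫ v, g v ∂(finExtLaw (Finset.Icc 1 (N : ℤ)) νV) := by
  have := hνV.1
  exact integral_prod_mul f g

lemma integral_drive_fst_mul_fst (hνV : IsVLaw νV) {k l : ℤ}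
    (hk : k ∈ Finset.Icc 0 ((N : ℤ) + 1)) (hl : l ∈ Finset.Icc 0 ((N : ℤ) + 1)) :
    ∫ d, (d.1 k - 1 / 2) * (d.1 l - 1 / 2) ∂(siloDriveLaw N νV) =
      if k = l then 1 / 12 else 0 := by
  split_ifs with hkl
  · subst hkl
    have h := measurePreserving_drive_fst N hνV hk
    rw [← integral_unif01_sub_half_sq, ← h.map_eq,
      integral_map h.measurable.aemeasurable (by fun_prop)]
  · have := hνV.1
    have h := integral_drive_fst_mul_snd N hνV
      (f := fun u => (u k - 1 / 2) * (u l - 1 / 2)) (g := fun _ => 1)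
    simp only [mul_one] at h
    rw [h, integral_finExtLaw_mul unif01 hk hl hkl (f := fun x => x - 1 / 2)
      (g := fun x => x - 1 / 2) (by fun_prop) (by fun_prop), integral_unif01_sub_half]
    simp

lemma integral_drive_snd_mul_snd (hνV : IsVLaw νV) {i j : ℤ}
    (hi : i ∈ Finset.Icc 1 (N : ℤ)) (hj : j ∈ Finset.Icc 1 (N : ℤ)) :
    ∫ d, (d.2 i - 1) * (d.2 j - 1) ∂(siloDriveLaw N νV) =
      if i = j then (∫ x, x ^ 2 ∂νV) - 1 else 0 := by
  split_ifs with hij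
  · subst hij
    have h := measurePreserving_drive_snd N hνV hi
    rw [← hνV.integral_sub_one_sq]
    conv_rhs => rw [← h.map_eq]
    rw [integral_map h.measurable.aemeasurable (by fun_prop)]
  · have := hνV.1
    have h := integral_drive_fst_mul_snd N hνV (f := fun _ => 1)
      (g := fun v => (v i - 1) * (v j - 1))
    simp only [one_mul] at h
    rw [h, integral_finExtLaw_mul νV hi hj hij (f := fun x => x - 1)
      (g := fun x => x - 1) (by fun_prop) (by fun_prop), hνV.integral_sub_one]
    simp

lemma integral_drive_fst_mul_snd_eq_zero (hνV : IsVLaw νV) {k : ℤ}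
    (hk : k ∈ Finset.Icc 0 ((N : ℤ) + 1)) (g : (ℤ → ℝ) → ℝ) :
    ∫ d, (d.1 k - 1 / 2) * g d.2 ∂(siloDriveLaw N νV) = 0 := by
  rw [integral_drive_fst_mul_snd N hνV (f := fun u => u k - 1 / 2)]
  have h := integral_drive_fst_mul_snd N hνV (f := fun u => u k - 1 / 2) (g := fun _ => 1)
  have := hνV.1
  simp only [mul_one, integral_drive_fst N hνV hk, integral_const, probReal_univ,
    smul_eq_mul] at h
  rw [← h, zero_mul]

end DriveMoments

section OneStep

lemma integral_sum_mul_sum {Y ι : Type*} [MeasurableSpace Y] [Fintype ι] (D : Measure Y)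
    (e e' : ι → Y → ℝ) (he : ∀ s, MemLp (e s) 2 D) (he' : ∀ s, MemLp (e' s) 2 D) (a b : ι → ℝ) :
    ∫ y, (∑ s, a s * e s y) * (∑ t, b t * e' t y) ∂D =
      ∑ s, ∑ t, a s * b t * ∫ y, e s y * e' t y ∂D := by
  have hi : ∀ s t, Integrable (fun y => a s * b t * (e s y * e' t y)) D :=
    fun s t => ((he s).integrable_mul (he' t)).const_mul _
  simp only [Finset.sum_mul_sum]
  have e1 : ∀ y s t, a s * e s y * (b t * e' t y) = a s * b t * (e s y * e' t y) :=
    fun y s t => by ring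
  simp only [e1]
  rw [integral_finsetSum _ fun s _ => integrable_finsetSum _ fun t _ => hi s t]
  refine Finset.sum_congr rfl fun s _ => ?_
  rw [integral_finsetSum _ fun t _ => hi s t]
  exact Finset.sum_congr rfl fun t _ => integral_const_mul _ _

variable {νV : Measure ℝ} (N : ℕ)

lemma measurable_trunc_apply (k : ℤ) : Measurable fun w : ℤ → ℝ => trunc N w k := by
  unfold trunc
  split_ifs <;> fun_prop

lemma measurable_siloStep : Measurable
    fun p : (ℤ → ℝ) × ((ℤ → ℝ) × (ℤ → ℝ)) => siloStep N p.2.1 p.2.2 p.1 := by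
  refine measurable_pi_lambda _ fun i => ?_
  unfold siloStep
  have h1 := (measurable_trunc_apply N (i + 1)).comp
    (measurable_fst : Measurable fun p : (ℤ → ℝ) × ((ℤ → ℝ) × (ℤ → ℝ)) => p.1)
  have h2 := (measurable_trunc_apply N (i - 1)).comp
    (measurable_fst : Measurable fun p : (ℤ → ℝ) × ((ℤ → ℝ) × (ℤ → ℝ)) => p.1)
  simp only [Function.comp_def] at h1 h2
  conv => enter [1, p]; rw [trunc]
  split_ifs <;> fun_prop

/-- The conditional mean of `W_t(i)` given `W_{t-1} = w`. -/
def siloStepMean (w : ℤ → ℝ) (i : ℤ) : ℝ := 1 + (trunc N w (i + 1) + trunc N w (i - 1)) / 2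

/-- The centred random variables driving the `i`-th coordinate of one silo step. -/
def siloNoise (i : ℤ) : Fin 4 → (ℤ → ℝ) × (ℤ → ℝ) → ℝ :=
  ![fun _ => 1, fun d => d.2 i - 1, fun d => d.1 (i + 1) - 1 / 2, fun d => d.1 (i - 1) - 1 / 2]

/-- The coefficients of `siloStep` in terms of `siloNoise`. -/
def siloCoeff (w : ℤ → ℝ) (i : ℤ) : Fin 4 → ℝ :=
  ![siloStepMean N w i, 1, trunc N w (i + 1), -trunc N w (i - 1)]

lemma siloStep_eq_sum (w : ℤ → ℝ) (d : (ℤ → ℝ) × (ℤ → ℝ)) {i : ℤ} (hi1 : 1 ≤ i) (hiN : i ≤ N) :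
    siloStep N d.1 d.2 w i = ∑ s, siloCoeff N w i s * siloNoise i s d := by
  simp only [Fin.sum_univ_four, siloCoeff, siloNoise, siloStepMean]
  rw [siloStep, trunc, if_pos ⟨hi1, hiN⟩]
  simp
  ring

lemma memLp_siloNoise (hνV : IsVLaw νV) {i : ℤ} (hi1 : 1 ≤ i) (hiN : i ≤ N) (s : Fin 4) :
    MemLp (siloNoise i s) 2 (siloDriveLaw N νV) := by
  have := isProbabilityMeasure_siloDriveLaw N hνV
  fin_cases s
  · exact memLp_const 1
  · exact (memLp_drive_snd N hνV (Finset.mem_Icc.2 ⟨hi1, hiN⟩)).sub (memLp_const 1)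
  · exact memLp_drive_fst N hνV (Finset.mem_Icc.2 ⟨by omega, by omega⟩)
  · exact memLp_drive_fst N hνV (Finset.mem_Icc.2 ⟨by omega, by omega⟩)

lemma integral_siloStep (hνV : IsVLaw νV) (w : ℤ → ℝ) {i : ℤ} (hi1 : 1 ≤ i) (hiN : i ≤ N) :
    ∫ d, siloStep N d.1 d.2 w i ∂(siloDriveLaw N νV) = siloStepMean N w i := by
  have := isProbabilityMeasure_siloDriveLaw N hνV
  simp only [siloStep_eq_sum N w _ hi1 hiN]
  rw [integral_finsetSum _ fun s _ =>
    ((memLp_siloNoise N hνV hi1 hiN s).integrable (by norm_num)).const_mul _]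
  simp only [integral_const_mul, Fin.sum_univ_four, siloCoeff, siloNoise]
  simp [integral_drive_snd N hνV (Finset.mem_Icc.2 ⟨hi1, hiN⟩),
    (one_div (2 : ℝ)) ▸ integral_drive_fst N hνV (k := i + 1)
      (Finset.mem_Icc.2 ⟨by omega, by omega⟩),
    (one_div (2 : ℝ)) ▸ integral_drive_fst N hνV (k := i - 1)
      (Finset.mem_Icc.2 ⟨by omega, by omega⟩)]

lemma integral_siloStep_mul_siloStep (hνV : IsVLaw νV) (w : ℤ → ℝ) {i j : ℤ}
    (hi1 : 1 ≤ i) (hiN : i ≤ N) (hj1 : 1 ≤ j) (hjN : j ≤ N) :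
    ∫ d, siloStep N d.1 d.2 w i * siloStep N d.1 d.2 w j ∂(siloDriveLaw N νV) =
      siloStepMean N w i * siloStepMean N w j +
        (if i = j then (∫ x, x ^ 2 ∂νV) - 1 + (trunc N w (i + 1) * trunc N w (j + 1) +
          trunc N w (i - 1) * trunc N w (j - 1)) / 12 else 0) -
        (if i + 1 = j - 1 then trunc N w (i + 1) * trunc N w (j - 1) / 12 else 0) -
        (if i - 1 = j + 1 then trunc N w (i - 1) * trunc N w (j + 1) / 12 else 0) := by
  have := isProbabilityMeasure_siloDriveLaw N hνV
  simp only [siloStep_eq_sum N w _ hi1 hiN, siloStep_eq_sum N w _ hj1 hjN]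
  rw [integral_sum_mul_sum _ _ _ (memLp_siloNoise N hνV hi1 hiN)
    (memLp_siloNoise N hνV hj1 hjN)]
  have mi : i ∈ Finset.Icc 1 (N : ℤ) := Finset.mem_Icc.2 ⟨hi1, hiN⟩
  have mj : j ∈ Finset.Icc 1 (N : ℤ) := Finset.mem_Icc.2 ⟨hj1, hjN⟩
  have mip : i + 1 ∈ Finset.Icc 0 ((N : ℤ) + 1) := Finset.mem_Icc.2 ⟨by omega, by omega⟩
  have mim : i - 1 ∈ Finset.Icc 0 ((N : ℤ) + 1) := Finset.mem_Icc.2 ⟨by omega, by omega⟩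
  have mjp : j + 1 ∈ Finset.Icc 0 ((N : ℤ) + 1) := Finset.mem_Icc.2 ⟨by omega, by omega⟩
  have mjm : j - 1 ∈ Finset.Icc 0 ((N : ℤ) + 1) := Finset.mem_Icc.2 ⟨by omega, by omega⟩
  have hswap : ∀ {k : ℤ} (_ : k ∈ Finset.Icc 0 ((N : ℤ) + 1)) (l : ℤ),
      ∫ d, (d.2 l - 1) * (d.1 k - 1 / 2) ∂(siloDriveLaw N νV) = 0 := fun hk l => by
    simp only [mul_comm (_ - (1 : ℝ))]
    exact integral_drive_fst_mul_snd_eq_zero N hνV hk fun v => v l - 1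
  simp only [Fin.sum_univ_four, siloCoeff, siloNoise, Matrix.cons_val, one_mul, mul_one,
    integral_const, probReal_univ, smul_eq_mul,
    integral_drive_fst N hνV mip, integral_drive_fst N hνV mim, integral_drive_fst N hνV mjp,
    integral_drive_fst N hνV mjm, integral_drive_snd N hνV mi, integral_drive_snd N hνV mj,
    integral_drive_snd_mul_snd N hνV mi mj, hswap mjp, hswap mjm,
    integral_drive_fst_mul_snd_eq_zero N hνV mip fun v => v j - 1,
    integral_drive_fst_mul_snd_eq_zero N hνV mim fun v => v j - 1,
    integral_drive_fst_mul_fst N hνV mip mjp, integral_drive_fst_mul_fst N hνV mip mjm,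
    integral_drive_fst_mul_fst N hνV mim mjp, integral_drive_fst_mul_fst N hνV mim mjm,
    add_left_inj, sub_left_inj]
  split_ifs <;> ring

end OneStep

section Integrability

variable (N : ℕ)

lemma sum_mul_shift_le (c G : ℤ → ℝ) (hc : ∀ k, 0 ≤ k → k ≤ (N : ℤ) + 1 → 0 ≤ c k)
    (hG : ∀ k, 0 ≤ G k) (hG0 : ∀ k, ¬(1 ≤ k ∧ k ≤ (N : ℤ)) → G k = 0) (a : ℤ)
    (ha : a = 1 ∨ a = -1) :
    ∑ i ∈ Finset.Icc 1 (N : ℤ), c i * G (i + a) ≤ ∑ k ∈ Finset.Icc 1 (N : ℤ), c (k - a) * G k := by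
  have e : ∑ i ∈ Finset.Icc 1 (N : ℤ), c i * G (i + a) =
      ∑ k ∈ Finset.Icc (1 + a) ((N : ℤ) + a), c (k - a) * G k := by
    rw [← Finset.map_add_right_Icc, Finset.sum_map]
    simp
  have e' : ∑ k ∈ Finset.Icc 1 (N : ℤ), c (k - a) * G k =
      ∑ k ∈ Finset.Icc 0 ((N : ℤ) + 1), c (k - a) * G k := by
    refine Finset.sum_subset (Finset.Icc_subset_Icc (by omega) (by omega)) fun k _ hk => ?_
    rw [hG0 k (by simpa using hk), mul_zero]
  rw [e, e']
  refine Finset.sum_le_sum_of_subset_of_nonneg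
    (Finset.Icc_subset_Icc (by omega) (by omega)) fun k _ _ => ?_
  by_cases hk : 1 ≤ k ∧ k ≤ (N : ℤ)
  · exact mul_nonneg (hc _ (by omega) (by omega)) (hG k)
  · rw [hG0 k hk, mul_zero]

/-- The event on which a silo configuration lies in `[0,∞)^{Λ^N}`. -/
def IsSiloConfig (w : ℤ → ℝ) : Prop := ∀ i : ℤ, 0 ≤ w i ∧ (¬(1 ≤ i ∧ i ≤ (N : ℤ)) → w i = 0)

variable {N}

lemma IsSiloConfig.trunc_eq {w : ℤ → ℝ} (hw : IsSiloConfig N w) : trunc N w = w := by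
  funext i
  unfold trunc
  split_ifs with h
  · rfl
  · exact ((hw i).2 h).symm

lemma sum_mul_siloStep_le {w u v : ℤ → ℝ} (hw : IsSiloConfig N w) (c : ℤ → ℝ)
    (hc : ∀ k, 0 ≤ k → k ≤ (N : ℤ) + 1 → 0 ≤ c k)
    (hu : ∀ k ∈ Finset.Icc 0 ((N : ℤ) + 1), 0 ≤ u k ∧ u k ≤ 1) :
    ∑ i ∈ Finset.Icc 1 (N : ℤ), c i * siloStep N u v w i ≤
      (∑ i ∈ Finset.Icc 1 (N : ℤ), c i * v i) +
        (∑ k ∈ Finset.Icc 1 (N : ℤ), c (k - 1) * (w k * u k)) +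
        ∑ k ∈ Finset.Icc 1 (N : ℤ), c (k + 1) * (w k * (1 - u k)) := by
  have hz : ∀ k, ¬(1 ≤ k ∧ k ≤ (N : ℤ)) → w k = 0 := fun k => (hw k).2
  have h1 := sum_mul_shift_le N c (fun k => w k * u k) hc ?_
    (fun k hk => by simp [hz k hk]) 1 (Or.inl rfl)
  have h2 := sum_mul_shift_le N c (fun k => w k * (1 - u k)) hc ?_
    (fun k hk => by simp [hz k hk]) (-1) (Or.inr rfl)
  · simp only [sub_neg_eq_add, ← sub_eq_add_neg] at h2
    refine le_trans (le_of_eq ?_) (add_le_add (add_le_add le_rfl h1) h2)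
    rw [← Finset.sum_add_distrib, ← Finset.sum_add_distrib]
    refine Finset.sum_congr rfl fun i hi => ?_
    rw [siloStep, hw.trunc_eq, trunc, if_pos (Finset.mem_Icc.1 hi)]
    ring
  all_goals
    intro k
    by_cases hk : 1 ≤ k ∧ k ≤ (N : ℤ)
    · have := hu k (Finset.mem_Icc.2 ⟨by omega, by omega⟩)
      exact mul_nonneg (hw k).1 (by linarith)
    · simp [hz k hk]

lemma siloStep_nonneg {w u v : ℤ → ℝ} (hw : IsSiloConfig N w)
    (hu : ∀ k ∈ Finset.Icc 0 ((N : ℤ) + 1), 0 ≤ u k ∧ u k ≤ 1)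
    (hv : ∀ i ∈ Finset.Icc 1 (N : ℤ), 0 ≤ v i) (i : ℤ) : 0 ≤ siloStep N u v w i := by
  rw [siloStep, hw.trunc_eq, trunc]
  split_ifs with h
  · have h1 := hu (i + 1) (Finset.mem_Icc.2 ⟨by omega, by omega⟩)
    have h2 := hu (i - 1) (Finset.mem_Icc.2 ⟨by omega, by omega⟩)
    exact add_nonneg (add_nonneg (hv i (Finset.mem_Icc.2 h)) (mul_nonneg (hw _).1 h1.1))
      (mul_nonneg (hw _).1 (by linarith))
  · exact le_rfl

variable (N)

/-- The total mass of a configuration weighted by `c`. -/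
def siloSum (c w : ℤ → ℝ) : ℝ := ∑ i ∈ Finset.Icc 1 (N : ℤ), c i * w i

lemma measurable_siloSum (c : ℤ → ℝ) : Measurable (siloSum N c) := by
  unfold siloSum
  fun_prop

lemma siloMean_le (i : ℤ) : siloMean N i ≤ ((N : ℝ) + 1) ^ 2 := by
  simp only [siloMean]
  nlinarith [sq_nonneg ((N : ℝ) + 1 - 2 * i), sq_nonneg ((N : ℝ) + 1)]

lemma siloSum_siloStep_le {w : ℤ → ℝ} {u v : ℤ → ℝ} (hw : IsSiloConfig N w)
    (hu : ∀ k ∈ Finset.Icc 0 ((N : ℤ) + 1), 0 ≤ u k ∧ u k ≤ 1) :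
    siloSum N 1 (siloStep N u v w) ≤ siloSum N 1 w + siloSum N 1 v := by
  refine (sum_mul_siloStep_le hw 1 (fun _ _ _ => zero_le_one) hu).trans (le_of_eq ?_)
  simp only [siloSum, Pi.one_apply, one_mul]
  rw [add_assoc, ← Finset.sum_add_distrib, add_comm]
  congr 1
  exact Finset.sum_congr rfl fun k _ => by ring

lemma siloSum_siloMean_siloStep_le {w : ℤ → ℝ} {u v : ℤ → ℝ} (hw : IsSiloConfig N w)
    (hu : ∀ k ∈ Finset.Icc 0 ((N : ℤ) + 1), 0 ≤ u k ∧ u k ≤ 1) :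
    siloSum N (siloMean N) (siloStep N u v w) ≤
      siloSum N (siloMean N) v + (siloSum N (siloMean N) w - siloSum N 1 w) +
        ∑ k ∈ Finset.Icc 1 (N : ℤ),
          (siloMean N (k - 1) - siloMean N (k + 1)) * w k * (u k - 1 / 2) := by
  refine (sum_mul_siloStep_le hw _ (siloMean_nonneg N) hu).trans (le_of_eq ?_)
  simp only [siloSum, Pi.one_apply, one_mul]
  rw [add_assoc, add_assoc]
  congr 1
  simp only [← Finset.sum_add_distrib, ← Finset.sum_sub_distrib]
  refine Finset.sum_congr rfl fun k _ => ?_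
  simp only [siloMean]
  push_cast
  ring

variable {N} {νV : Measure ℝ}

lemma ae_drive_mem (hνV : IsVLaw νV) : ∀ᵐ d ∂(siloDriveLaw N νV),
    (∀ k ∈ Finset.Icc 0 ((N : ℤ) + 1), 0 ≤ d.1 k ∧ d.1 k ≤ 1) ∧
      ∀ i ∈ Finset.Icc 1 (N : ℤ), 0 ≤ d.2 i := by
  refine Eventually.and ?_ ?_
  · refine (Finset.eventually_all _).2 fun k hk => ?_
    have h : ∀ᵐ x ∂unif01, 0 ≤ x ∧ x ≤ 1 := ae_restrict_mem measurableSet_Icc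
    exact (measurePreserving_drive_fst N hνV hk).quasiMeasurePreserving.ae h
  · refine (Finset.eventually_all _).2 fun i hi => ?_
    have h : ∀ᵐ x ∂νV, 0 ≤ x := by
      rw [ae_iff]
      simpa using hνV.2.1
    exact (measurePreserving_drive_snd N hνV hi).quasiMeasurePreserving.ae h

lemma memLp_siloSum_snd (hνV : IsVLaw νV) (c : ℤ → ℝ) :
    MemLp (fun d : (ℤ → ℝ) × (ℤ → ℝ) => siloSum N c d.2) 2 (siloDriveLaw N νV) :=
  memLp_finsetSum _ fun _ hi => (memLp_drive_snd N hνV hi).const_mul _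

/-- One silo step decreases, on average, the product of the total mass with the mass weighted
by `siloMean`, by the squared total mass up to lower order terms. -/
lemma exists_silo_drift (N : ℕ) (hνV : IsVLaw νV) : ∃ b : ℝ, 0 ≤ b ∧ ∀ w, IsSiloConfig N w →
    Integrable (fun d => |siloSum N 1 (siloStep N d.1 d.2 w)| *
      |siloSum N (siloMean N) (siloStep N d.1 d.2 w)|) (siloDriveLaw N νV) ∧
    ∫ d, |siloSum N 1 (siloStep N d.1 d.2 w)| *
      |siloSum N (siloMean N) (siloStep N d.1 d.2 w)| ∂(siloDriveLaw N νV) ≤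
      |siloSum N 1 w| * |siloSum N (siloMean N) w| - siloSum N 1 w ^ 2 / 2 + b := by
  have := isProbabilityMeasure_siloDriveLaw N hνV
  set D := siloDriveLaw N νV
  set p := ∫ d, siloSum N 1 d.2 ∂D
  set q := ∫ d, siloSum N (siloMean N) d.2 ∂D
  set K := ∫ d, siloSum N 1 d.2 * siloSum N (siloMean N) d.2 ∂D
  set H : ℝ := ((N : ℝ) + 1) ^ 2 with hH
  have hH1 : 1 ≤ H := by
    rw [hH]; nlinarith [(Nat.cast_nonneg N : (0 : ℝ) ≤ N)]
  refine ⟨(|q| + H * |p|) ^ 2 / 2 + |K|, by positivity, fun w hw => ?_⟩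
  have hS0 : 0 ≤ siloSum N 1 w :=
    Finset.sum_nonneg fun i _ => mul_nonneg zero_le_one (hw i).1
  have hmi : ∀ i ∈ Finset.Icc 1 (N : ℤ), 0 ≤ siloMean N i := fun i hi => by
    rw [Finset.mem_Icc] at hi
    exact siloMean_nonneg N i (by omega) (by omega)
  have hF0 : 0 ≤ siloSum N (siloMean N) w :=
    Finset.sum_nonneg fun i hi => mul_nonneg (hmi i hi) (hw i).1
  have hFS : siloSum N (siloMean N) w ≤ H * siloSum N 1 w := by
    simp only [siloSum, Finset.mul_sum, Pi.one_apply, one_mul]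
    exact Finset.sum_le_sum fun i _ => mul_le_mul_of_nonneg_right (siloMean_le N i) (hw i).1
  set S0 := siloSum N 1 w
  set F0 := siloSum N (siloMean N) w
  set X : (ℤ → ℝ) × (ℤ → ℝ) → ℝ := fun d => ∑ k ∈ Finset.Icc 1 (N : ℤ),
    (siloMean N (k - 1) - siloMean N (k + 1)) * w k * (d.1 k - 1 / 2) with hX
  have hkk : ∀ k ∈ Finset.Icc 1 (N : ℤ), k ∈ Finset.Icc 0 ((N : ℤ) + 1) := fun k hk => by
    rw [Finset.mem_Icc] at hk ⊢
    omega
  have hXL : MemLp X 2 D :=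
    memLp_finsetSum _ fun k hk => (memLp_drive_fst N hνV (hkk k hk)).const_mul _
  have hA : MemLp (fun d => S0 + siloSum N 1 d.2) 2 D :=
    (memLp_const S0).add (memLp_siloSum_snd hνV 1)
  have hB : MemLp (fun d => siloSum N (siloMean N) d.2 + (F0 - S0)) 2 D :=
    (memLp_siloSum_snd hνV _).add (memLp_const _)
  have hAB : Integrable (fun d => (S0 + siloSum N 1 d.2) *
      (siloSum N (siloMean N) d.2 + (F0 - S0))) D := hA.integrable_mul hB
  have hAX : Integrable (fun d => (S0 + siloSum N 1 d.2) * X d) D := hA.integrable_mul hXL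
  have hsum : Integrable (fun d => (S0 + siloSum N 1 d.2) *
      (siloSum N (siloMean N) d.2 + (F0 - S0)) + (S0 + siloSum N 1 d.2) * X d) D := hAB.add hAX
  have hbound : ∀ᵐ d ∂D, |siloSum N 1 (siloStep N d.1 d.2 w)| *
      |siloSum N (siloMean N) (siloStep N d.1 d.2 w)| ≤
      (S0 + siloSum N 1 d.2) * (siloSum N (siloMean N) d.2 + (F0 - S0)) +
        (S0 + siloSum N 1 d.2) * X d := by
    filter_upwards [ae_drive_mem hνV] with d hd
    have hn := siloStep_nonneg hw hd.1 hd.2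
    have a1 : 0 ≤ siloSum N 1 (siloStep N d.1 d.2 w) :=
      Finset.sum_nonneg fun i _ => mul_nonneg zero_le_one (hn i)
    have a2 : 0 ≤ siloSum N (siloMean N) (siloStep N d.1 d.2 w) :=
      Finset.sum_nonneg fun i hi => mul_nonneg (hmi i hi) (hn i)
    have b1 := siloSum_siloStep_le N (v := d.2) hw hd.1
    rw [abs_of_nonneg a1, abs_of_nonneg a2, ← mul_add]
    exact mul_le_mul b1 (siloSum_siloMean_siloStep_le N hw hd.1) a2 (a1.trans b1)
  have hmeas : Measurable fun d : (ℤ → ℝ) × (ℤ → ℝ) => siloStep N d.1 d.2 w :=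
    (measurable_siloStep N).comp measurable_prodMk_left
  have hintg : Integrable (fun d => |siloSum N 1 (siloStep N d.1 d.2 w)| *
      |siloSum N (siloMean N) (siloStep N d.1 d.2 w)|) D := by
    refine Integrable.mono' hsum ?_ ?_
    · exact (((measurable_siloSum N 1).comp hmeas).abs.mul
        ((measurable_siloSum N _).comp hmeas).abs).aestronglyMeasurable
    · filter_upwards [hbound] with d hd
      rw [Real.norm_of_nonneg (by positivity)]
      exact hd
  refine ⟨hintg, (integral_mono_ae hintg hsum hbound).trans ?_⟩
  have i1 : Integrable (fun d : (ℤ → ℝ) × (ℤ → ℝ) => siloSum N 1 d.2) D :=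
    (memLp_siloSum_snd hνV 1).integrable (by norm_num)
  have i2 : Integrable (fun d : (ℤ → ℝ) × (ℤ → ℝ) => siloSum N (siloMean N) d.2) D :=
    (memLp_siloSum_snd hνV _).integrable (by norm_num)
  have i3 : Integrable (fun d : (ℤ → ℝ) × (ℤ → ℝ) =>
      siloSum N 1 d.2 * siloSum N (siloMean N) d.2) D :=
    (memLp_siloSum_snd hνV 1).integrable_mul (memLp_siloSum_snd hνV _)
  have hX0 : ∫ d, (S0 + siloSum N 1 d.2) * X d ∂D = 0 := by
    simp only [hX, Finset.mul_sum]
    rw [integral_finsetSum]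
    · refine Finset.sum_eq_zero fun k hk => ?_
      have e : ∀ d : (ℤ → ℝ) × (ℤ → ℝ), (S0 + siloSum N 1 d.2) *
          ((siloMean N (k - 1) - siloMean N (k + 1)) * w k * (d.1 k - 1 / 2)) =
          (siloMean N (k - 1) - siloMean N (k + 1)) * w k *
            ((d.1 k - 1 / 2) * (S0 + siloSum N 1 d.2)) := fun d => by ring
      simp only [e]
      rw [integral_const_mul, integral_drive_fst_mul_snd_eq_zero N hνV (hkk k hk)
        fun v => S0 + siloSum N 1 v, mul_zero]
    · intro k hk
      exact hA.integrable_mul ((memLp_drive_fst N hνV (hkk k hk)).const_mul _)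
  have hAB' : ∫ d, (S0 + siloSum N 1 d.2) * (siloSum N (siloMean N) d.2 + (F0 - S0)) ∂D =
      K + S0 * q + (F0 - S0) * p + S0 * (F0 - S0) := by
    have e : ∀ d : (ℤ → ℝ) × (ℤ → ℝ), (S0 + siloSum N 1 d.2) *
        (siloSum N (siloMean N) d.2 + (F0 - S0)) =
        siloSum N 1 d.2 * siloSum N (siloMean N) d.2 + S0 * siloSum N (siloMean N) d.2 +
          (F0 - S0) * siloSum N 1 d.2 + S0 * (F0 - S0) := fun d => by ring
    simp only [e]
    have j1 : Integrable (fun d : (ℤ → ℝ) × (ℤ → ℝ) =>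
      siloSum N 1 d.2 * siloSum N (siloMean N) d.2 + S0 * siloSum N (siloMean N) d.2) D :=
      i3.add (i2.const_mul _)
    have j2 : Integrable (fun d : (ℤ → ℝ) × (ℤ → ℝ) =>
      siloSum N 1 d.2 * siloSum N (siloMean N) d.2 + S0 * siloSum N (siloMean N) d.2 +
        (F0 - S0) * siloSum N 1 d.2) D := j1.add (i1.const_mul _)
    rw [integral_add j2 (integrable_const _), integral_add j1 (i1.const_mul _),
      integral_add i3 (i2.const_mul _), integral_const_mul, integral_const_mul]
    simp [p, q, K]
  rw [integral_add hAB hAX, hX0, hAB', abs_of_nonneg hS0, abs_of_nonneg hF0]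
  have k1 : S0 * q ≤ S0 * |q| := mul_le_mul_of_nonneg_left (le_abs_self q) hS0
  have k2 : (F0 - S0) * p ≤ H * S0 * |p| := by
    refine (le_abs_self _).trans ?_
    rw [abs_mul]
    refine mul_le_mul_of_nonneg_right (abs_le.2 ⟨?_, ?_⟩) (abs_nonneg p)
    · nlinarith
    · linarith
  nlinarith [sq_nonneg (S0 - (|q| + H * |p|)), le_abs_self K]

lemma IsSiloInvariant.ae_isSiloConfig {μ : Measure (ℤ → ℝ)} (hμ : IsSiloInvariant N νV μ) :
    ∀ᵐ w ∂μ, IsSiloConfig N w := by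
  have := hμ.1
  have hm : MeasurableSet {w : ℤ → ℝ | IsSiloConfig N w} := by
    have : {w : ℤ → ℝ | IsSiloConfig N w} =
        ⋂ i : ℤ, {w | 0 ≤ w i ∧ (¬(1 ≤ i ∧ i ≤ (N : ℤ)) → w i = 0)} := by
      ext w; simp [IsSiloConfig]
    rw [this]
    refine MeasurableSet.iInter fun i => ?_
    refine (measurableSet_le measurable_const (measurable_pi_apply i)).inter ?_
    by_cases h : 1 ≤ i ∧ i ≤ (N : ℤ)
    · simp only [h, and_self, not_true_eq_false, false_imp_iff]
      exact MeasurableSet.univ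
    · simp only [h, not_false_eq_true, true_imp_iff]
      exact measurableSet_eq_fun (measurable_pi_apply i) measurable_const
  exact (prob_compl_eq_zero_iff hm).2 hμ.2.1

lemma IsSiloInvariant.memLp_eval (hνV : IsVLaw νV) {μ : Measure (ℤ → ℝ)}
    (hμ : IsSiloInvariant N νV μ) (i : ℤ) : MemLp (fun w : ℤ → ℝ => w i) 2 μ := by
  have := hμ.1
  have := isProbabilityMeasure_siloDriveLaw N hνV
  obtain ⟨b, hb, hdrift⟩ := exists_silo_drift N hνV
  have hS := measurable_siloSum N 1
  have hF := measurable_siloSum N (siloMean N)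
  have hintg : Integrable (fun w => siloSum N 1 w ^ 2 / 2) μ :=
    integrable_of_drift μ (siloDriveLaw N νV) _ (measurable_siloStep N) hμ.2.2
      (fun w => |siloSum N 1 w| * |siloSum N (siloMean N) w|) _
      (hS.abs.mul hF.abs) (by fun_prop) (fun w => by positivity) (fun w => by positivity) b hb
      (hμ.ae_isSiloConfig.mono fun w hw => hdrift w hw)
  have hL : MemLp (siloSum N 1) 2 μ := by
    refine (memLp_two_iff_integrable_sq hS.aestronglyMeasurable).2 ?_
    simpa using hintg.mul_const 2
  refine hL.mono (measurable_pi_apply i).aestronglyMeasurable ?_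
  filter_upwards [hμ.ae_isSiloConfig] with w hw
  have hS0 : 0 ≤ siloSum N 1 w :=
    Finset.sum_nonneg fun i _ => mul_nonneg zero_le_one (hw i).1
  rw [Real.norm_of_nonneg (hw i).1, Real.norm_of_nonneg hS0]
  by_cases h : 1 ≤ i ∧ i ≤ (N : ℤ)
  · have := Finset.single_le_sum (f := fun i => (1 : ℤ → ℝ) i * w i)
      (fun j _ => mul_nonneg zero_le_one (hw j).1) (Finset.mem_Icc.2 h)
    simpa [siloSum] using this
  · rw [(hw i).2 h]
    exact hS0

end Integrability

section MomentEquations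

variable {N : ℕ} {νV : Measure ℝ} {μ : Measure (ℤ → ℝ)}

lemma IsSiloInvariant.integral_eq (hνV : IsVLaw νV) (hμ : IsSiloInvariant N νV μ)
    {F : (ℤ → ℝ) → ℝ} (hF : Measurable F) (hFi : Integrable F μ) :
    ∫ w, F w ∂μ = ∫ w, ∫ d, F (siloStep N d.1 d.2 w) ∂(siloDriveLaw N νV) ∂μ := by
  have := hμ.1
  have := isProbabilityMeasure_siloDriveLaw N hνV
  have hT := (measurable_siloStep N).aemeasurable (μ := μ.prod (siloDriveLaw N νV))
  have hFi' : Integrable F ((μ.prod (siloDriveLaw N νV)).map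
      fun p => siloStep N p.2.1 p.2.2 p.1) := by rwa [hμ.2.2]
  conv_lhs => rw [← hμ.2.2]
  rw [integral_map hT hF.aestronglyMeasurable]
  exact integral_prod _ ((integrable_map_measure hF.aestronglyMeasurable hT).1 hFi')

lemma IsSiloInvariant.integral_eval_mul_eq_zero (hμ : IsSiloInvariant N νV μ) {i : ℤ}
    (hi : ¬(1 ≤ i ∧ i ≤ (N : ℤ))) (F : (ℤ → ℝ) → ℝ) : ∫ w, w i * F w ∂μ = 0 := by
  refine integral_eq_zero_of_ae ?_
  filter_upwards [hμ.ae_isSiloConfig] with w hw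
  simp [(hw i).2 hi]

lemma IsSiloInvariant.integral_eval (hνV : IsVLaw νV) (hμ : IsSiloInvariant N νV μ)
    (i : ℤ) (hi0 : 0 ≤ i) (hiN : i ≤ (N : ℤ) + 1) : ∫ w, w i ∂μ = siloMean N i := by
  have := hμ.1
  have hi : ∀ k : ℤ, Integrable (fun w : ℤ → ℝ => w k) μ :=
    fun k => (hμ.memLp_eval hνV k).integrable (by norm_num)
  refine eq_siloMean_of_average N (fun i => ∫ w, w i ∂μ) ?_ ?_ ?_ i hi0 hiN
  · simpa using hμ.integral_eval_mul_eq_zero (i := 0) (by omega) fun _ => 1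
  · simpa using hμ.integral_eval_mul_eq_zero (i := (N : ℤ) + 1) (by omega) fun _ => 1
  · intro i h1 h2
    rw [hμ.integral_eq hνV (measurable_pi_apply i) (hi i)]
    simp only [integral_siloStep N hνV _ h1 h2]
    have e : ∀ᵐ w ∂μ, siloStepMean N w i = 1 + (w (i + 1) + w (i - 1)) / 2 := by
      filter_upwards [hμ.ae_isSiloConfig] with w hw
      rw [siloStepMean, hw.trunc_eq]
    have hs : Integrable (fun w : ℤ → ℝ => w (i + 1) + w (i - 1)) μ := (hi _).add (hi _)
    rw [integral_congr_ae e, integral_add (integrable_const _) (hs.div_const 2),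
      integral_div, integral_add (hi _) (hi _)]
    simp

lemma IsSiloInvariant.integral_eval_mul_eval (hνV : IsVLaw νV) (hμ : IsSiloInvariant N νV μ)
    (i j : ℤ) (hi1 : 1 ≤ i) (hiN : i ≤ N) (hj1 : 1 ≤ j) (hjN : j ≤ N) :
    ∫ w, w i * w j ∂μ =
      1 + (siloMean N (i + 1) + siloMean N (i - 1)) / 2 +
        (siloMean N (j + 1) + siloMean N (j - 1)) / 2 +
        ((∫ w, w (i + 1) * w (j + 1) ∂μ) + (∫ w, w (i + 1) * w (j - 1) ∂μ) +
          (∫ w, w (i - 1) * w (j + 1) ∂μ) + ∫ w, w (i - 1) * w (j - 1) ∂μ) / 4 +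
        (if i = j then ((∫ x, x ^ 2 ∂νV) - 1) +
          ((∫ w, w (i + 1) * w (j + 1) ∂μ) + ∫ w, w (i - 1) * w (j - 1) ∂μ) / 12 else 0) -
        (if i + 1 = j - 1 then (∫ w, w (i + 1) * w (j - 1) ∂μ) / 12 else 0) -
        (if i - 1 = j + 1 then (∫ w, w (i - 1) * w (j + 1) ∂μ) / 12 else 0) := by
  have := hμ.1
  have hL := hμ.memLp_eval hνV
  have hm := hμ.integral_eval hνV
  have hI : ∀ k : ℤ, Integrable (fun w : ℤ → ℝ => w k) μ :=
    fun k => (hL k).integrable (by norm_num)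
  have hII : ∀ k l : ℤ, Integrable (fun w : ℤ → ℝ => w k * w l) μ :=
    fun k l => (hL k).integrable_mul (hL l)
  rw [hμ.integral_eq hνV (F := fun w => w i * w j) (by fun_prop) (hII i j)]
  simp only [integral_siloStep_mul_siloStep N hνV _ hi1 hiN hj1 hjN]
  rw [← hm (i + 1) (by omega) (by omega), ← hm (i - 1) (by omega) (by omega),
    ← hm (j + 1) (by omega) (by omega), ← hm (j - 1) (by omega) (by omega)]
  set β := ∫ x, x ^ 2 ∂νV
  have e : ∀ᵐ w ∂μ, siloStepMean N w i * siloStepMean N w j +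
        (if i = j then β - 1 + (trunc N w (i + 1) * trunc N w (j + 1) +
          trunc N w (i - 1) * trunc N w (j - 1)) / 12 else 0) -
        (if i + 1 = j - 1 then trunc N w (i + 1) * trunc N w (j - 1) / 12 else 0) -
        (if i - 1 = j + 1 then trunc N w (i - 1) * trunc N w (j + 1) / 12 else 0) =
      (1 + if i = j then β - 1 else 0) + 1 / 2 * w (i + 1) + 1 / 2 * w (i - 1) +
        1 / 2 * w (j + 1) + 1 / 2 * w (j - 1) +
        (1 / 4 + if i = j then 1 / 12 else 0) * (w (i + 1) * w (j + 1)) +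
        (1 / 4 - if i + 1 = j - 1 then 1 / 12 else 0) * (w (i + 1) * w (j - 1)) +
        (1 / 4 - if i - 1 = j + 1 then 1 / 12 else 0) * (w (i - 1) * w (j + 1)) +
        (1 / 4 + if i = j then 1 / 12 else 0) * (w (i - 1) * w (j - 1)) := by
    filter_upwards [hμ.ae_isSiloConfig] with w hw
    simp only [siloStepMean, hw.trunc_eq]
    split_ifs <;> ring
  have hadd : ∀ {f g : (ℤ → ℝ) → ℝ} {a b : ℝ} (c : ℝ),
      (Integrable f μ ∧ ∫ w, f w ∂μ = a) → (Integrable g μ ∧ ∫ w, g w ∂μ = b) →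
      Integrable (fun w => f w + c * g w) μ ∧ ∫ w, f w + c * g w ∂μ = a + c * b := by
    intro f g a b c hf hg
    refine ⟨hf.1.add (hg.1.const_mul c), ?_⟩
    rw [integral_add hf.1 (hg.1.const_mul c), integral_const_mul, hf.2, hg.2]
  have s0 : Integrable (fun _ : ℤ → ℝ => (1 : ℝ) + if i = j then β - 1 else 0) μ ∧
      ∫ _ : ℤ → ℝ, ((1 : ℝ) + if i = j then β - 1 else 0) ∂μ =
        1 + if i = j then β - 1 else 0 := ⟨integrable_const _, by simp⟩
  have hI' := fun k => (⟨hI k, rfl⟩ : _ ∧ _ = ∫ w : ℤ → ℝ, w k ∂μ)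
  have hII' := fun k l => (⟨hII k l, rfl⟩ : _ ∧ _ = ∫ w : ℤ → ℝ, w k * w l ∂μ)
  have s4 := hadd (1 / 2) (hadd (1 / 2) (hadd (1 / 2) (hadd (1 / 2) s0 (hI' (i + 1)))
    (hI' (i - 1))) (hI' (j + 1))) (hI' (j - 1))
  have s8 := hadd (1 / 4 + if i = j then 1 / 12 else 0)
    (hadd (1 / 4 - if i - 1 = j + 1 then 1 / 12 else 0)
      (hadd (1 / 4 - if i + 1 = j - 1 then 1 / 12 else 0)
        (hadd (1 / 4 + if i = j then 1 / 12 else 0) s4 (hII' (i + 1) (j + 1)))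
        (hII' (i + 1) (j - 1))) (hII' (i - 1) (j + 1))) (hII' (i - 1) (j - 1))
  rw [integral_congr_ae e, s8.2]
  split_ifs <;> ring

end MomentEquations

/-- The off-diagonal covariances under the invariant measure of the width-`N` silo are
of order `N³`, uniformly in `N`. -/
theorem silo_covariance_bound (νV : Measure ℝ) (hνV : IsVLaw νV) :
    ∃ C : ℝ, 0 < C ∧ ∀ N : ℕ, 1 ≤ N → ∀ μ : Measure (ℤ → ℝ), IsSiloInvariant N νV μ →
      ∀ i j : ℤ, 1 ≤ i → i ≤ (N : ℤ) → 1 ≤ j → j ≤ (N : ℤ) → i ≠ j →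
        |(∫ w : ℤ → ℝ, w i * w j ∂μ) -
            ((i : ℝ) * ((N : ℝ) + 1 - (i : ℝ))) * ((j : ℝ) * ((N : ℝ) + 1 - (j : ℝ)))| ≤
          C * (N : ℝ) ^ 3 := by
  have hβ : 0 ≤ ∫ x, x ^ 2 ∂νV := integral_nonneg fun x => sq_nonneg x
  refine ⟨4 + 4 * ∫ x, x ^ 2 ∂νV, by positivity, fun N hN μ hμ i j hi1 hiN hj1 hjN hij => ?_⟩
  refine covariance_bound_of_moment_equations N hN _ hβ (fun i j => ∫ w, w i * w j ∂μ) ?_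
    (hμ.integral_eval_mul_eval hνV) i j hi1 hiN hj1 hjN hij
  intro i j h
  by_cases hi : 1 ≤ i ∧ i ≤ (N : ℤ)
  · rw [← hμ.integral_eval_mul_eq_zero (i := j) (by omega) fun w => w i]
    exact integral_congr_ae (ae_of_all _ fun w => mul_comm _ _)
  · exact hμ.integral_eval_mul_eq_zero hi fun w => w j
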